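/- arXiv:2201.04760 — 4 statements merged into one kernel-verified Lean document; each statement's English description precedes it below -/
import Mathlib

section
/- Let G be a finite supersolvable group with o(G) < 31/12. Then exactly one of the following holds: (a) G is a 2-group with G' = Φ(G) and n_2(G) > (17/24)|G| − 3/2; (b) G is isomorphic to the cyclic group C_3; (c) G contains a normal elementary abelian 3-subgroup K of order 3^m (for some m ≥ 1) of index 2 such that every element of G outside K has order 2, and o(G) = (5·3^m − 2)/(2·3^m). -/
/-- The sum of the orders of all elements of `G`. -/
noncomputable def psi (G : Type*) [Group G] : ℕ := ∑ᶠ x : G, orderOf x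

/-- The average order of a finite group `G`, as a rational number. -/
noncomputable def avgOrder (G : Type*) [Group G] : ℚ := psi G / Nat.card G

/-- The number of elements of order `d` in `G`. -/
noncomputable def nOrd (G : Type*) [Group G] (d : ℕ) : ℕ := Nat.card {x : G // orderOf x = d}

/-- A group is supersolvable if it has a chain of subgroups
`⊥ = H 0 ≤ H 1 ≤ … ≤ H n = ⊤`, each normal in `G`, with all successive
quotients cyclic. -/
def IsSupersolvable (G : Type*) [Group G] : Prop :=
  ∃ (n : ℕ) (H : Fin (n + 1) → Subgroup G) (hnorm : ∀ i, (H i).Normal),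
    H 0 = ⊥ ∧ H (Fin.last n) = ⊤ ∧
    (∀ i : Fin n, H i.castSucc ≤ H i.succ) ∧
    ∀ i : Fin n,
      letI := (hnorm i.castSucc).subgroupOf (H i.succ)
      IsCyclic (↥(H i.succ) ⧸ (H i.castSucc).subgroupOf (H i.succ))

/-- Clause (a): `G` is a `2`-group with `G' = Φ(G)` and `n₂(G) > (17/24)|G| - 3/2`. -/
def ClauseA (G : Type*) [Group G] : Prop :=
  (∃ k : ℕ, Nat.card G = 2 ^ k) ∧ commutator G = frattini G ∧
    (nOrd G 2 : ℚ) > 17 / 24 * (Nat.card G : ℚ) - 3 / 2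

/-- Clause (b): `G ≅ C₃`. -/
def ClauseB (G : Type*) [Group G] : Prop := Nonempty (G ≃* Multiplicative (ZMod 3))

/-- Clause (c): `G` has a normal elementary abelian `3`-subgroup `K` of order `3 ^ m`
(`m ≥ 1`) and index `2`, every element outside `K` has order `2`, and
`o(G) = (5 · 3 ^ m - 2)/(2 · 3 ^ m)`. -/
def ClauseC (G : Type*) [Group G] : Prop :=
  ∃ (m : ℕ) (K : Subgroup G), 1 ≤ m ∧ K.Normal ∧
    Nat.card K = 3 ^ m ∧ K.index = 2 ∧
    (∀ x ∈ K, ∀ y ∈ K, x * y = y * x) ∧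
    (∀ x ∈ K, x ≠ 1 → orderOf x = 3) ∧
    (∀ x : G, x ∉ K → orderOf x = 2) ∧
    avgOrder G = (5 * 3 ^ m - 2 : ℚ) / (2 * 3 ^ m)

section OrderSums

variable {G : Type*} [Group G]

theorem psi_eq_sum [Fintype G] : psi G = ∑ x : G, orderOf x :=
  finsum_eq_sum_of_fintype _

theorem avgOrder_lt_iff [Finite G] : avgOrder G < 31 / 12 ↔ 12 * psi G < 31 * Nat.card G := by
  have hpos : (0 : ℚ) < Nat.card G := by exact_mod_cast Nat.card_pos
  rw [avgOrder, div_lt_div_iff₀ hpos (by norm_num)]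
  constructor
  · intro h
    have h' : ((12 * psi G : ℕ) : ℚ) < ((31 * Nat.card G : ℕ) : ℚ) := by
      push_cast; linarith
    exact_mod_cast h'
  · intro h
    have h' : ((12 * psi G : ℕ) : ℚ) < ((31 * Nat.card G : ℕ) : ℚ) := by exact_mod_cast h
    push_cast at h'
    linarith

/-- Lower bound for a sum over `G` of a function bounded below on the layers of `N ≤ D ≤ G`. -/
theorem layered_sum_le [Fintype G] {N D : Subgroup G} (hND : N ≤ D) (f : G → ℕ) (α β γ : ℕ)
    (hα : ∀ x ∈ N, α ≤ f x) (hβ : ∀ x ∈ D, x ∉ N → β ≤ f x) (hγ : ∀ x ∉ D, γ ≤ f x) :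
    (γ : ℤ) * Nat.card G + (β - γ) * Nat.card D + (α - β) * Nat.card N
      ≤ ((∑ x, f x : ℕ) : ℤ) := by
  classical
  have hcard (H : Subgroup G) : (Nat.card H : ℤ) = ∑ x : G, if x ∈ H then (1 : ℤ) else 0 := by
    rw [Finset.sum_boole, Nat.card_eq_fintype_card, Fintype.card_subtype]
  rw [hcard, hcard, Nat.card_eq_fintype_card, Finset.mul_sum, Finset.mul_sum]
  have hG : (γ : ℤ) * Fintype.card G = ∑ _x : G, (γ : ℤ) := by
    rw [Finset.sum_const, Finset.card_univ, nsmul_eq_mul, mul_comm]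
  rw [hG, ← Finset.sum_add_distrib, ← Finset.sum_add_distrib, Nat.cast_sum]
  refine Finset.sum_le_sum fun x _ => ?_
  by_cases hN : x ∈ N
  · have := hα x hN
    simp only [hN, hND hN, if_true]
    push_cast [← Nat.cast_le (α := ℤ)] at this
    linarith
  · by_cases hD : x ∈ D
    · have := hβ x hD hN
      simp only [hN, hD, if_true, if_false]
      push_cast [← Nat.cast_le (α := ℤ)] at this
      linarith
    · have := hγ x hD
      simp only [hN, hD, if_false]
      push_cast [← Nat.cast_le (α := ℤ)] at this
      linarith

theorem two_le_orderOf [Finite G] {x : G} (hx : x ≠ 1) : 2 ≤ orderOf x := by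
  have h0 := orderOf_pos x
  have h1 : orderOf x ≠ 1 := fun h => hx (orderOf_eq_one_iff.mp h)
  omega

theorem four_le_orderOf [Finite G] {x : G} (h2 : x ^ 2 ≠ 1) (h3 : x ^ 3 ≠ 1) :
    4 ≤ orderOf x := by
  have h0 := orderOf_pos x
  by_contra! h
  interval_cases hx : orderOf x
  · exact h2 (by rw [orderOf_eq_one_iff.mp hx, one_pow])
  · exact h2 (hx ▸ pow_orderOf_eq_one x)
  · exact h3 (hx ▸ pow_orderOf_eq_one x)

/-- `∑_{x} ∑_{n ∈ N} o(xn) = |N| ψ(G)`. -/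
theorem sum_coset_sums [Fintype G] (N : Subgroup G) [Fintype N] :
    ∑ x : G, ∑ n : N, orderOf (x * n) = Nat.card N * psi G := by
  rw [Finset.sum_comm, psi_eq_sum, Nat.card_eq_fintype_card, ← smul_eq_mul, ← Finset.card_univ,
    ← Finset.sum_const]
  exact Finset.sum_congr rfl fun n _ =>
    Equiv.sum_comp (Equiv.mulRight (n : G)) (fun x => orderOf x)

theorem sum_quotient_mul [Fintype G] (N : Subgroup G) [N.Normal] [Fintype (G ⧸ N)]
    (g : G ⧸ N → ℕ) :
    ∑ x : G, g (x : G ⧸ N) = Nat.card N * ∑ q, g q := by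
  classical
  have : Fintype N := Fintype.ofFinite N
  rw [← Finset.sum_fiberwise Finset.univ (fun x : G => (x : G ⧸ N)), Finset.mul_sum]
  refine Finset.sum_congr rfl fun q _ => ?_
  rw [Finset.sum_congr rfl (g := fun _ => g q)
    (fun x hx => by rw [(Finset.mem_filter.mp hx).2]), Finset.sum_const, smul_eq_mul]
  congr 1
  obtain ⟨y, rfl⟩ := QuotientGroup.mk_surjective q
  rw [Nat.card_eq_fintype_card, ← Finset.card_univ]
  symm
  refine Finset.card_bij (fun n _ => y * n) ?_ ?_ ?_
  · intro n _
    simp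
  · intro a _ b _ hab
    exact Subtype.ext (mul_left_cancel hab)
  · intro x hx
    refine ⟨⟨y⁻¹ * x, QuotientGroup.eq.mp (Finset.mem_filter.mp hx).2.symm⟩, by simp, by simp⟩

/-- The average order does not increase when passing to a quotient. -/
theorem low_quotient [Finite G] (N : Subgroup G) [N.Normal]
    (h : 12 * psi G < 31 * Nat.card G) : 12 * psi (G ⧸ N) < 31 * Nat.card (G ⧸ N) := by
  have : Fintype G := Fintype.ofFinite G
  have : Fintype (G ⧸ N) := Fintype.ofFinite _
  have hle : Nat.card N * psi (G ⧸ N) ≤ psi G := by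
    rw [psi_eq_sum, psi_eq_sum, ← sum_quotient_mul]
    exact Finset.sum_le_sum fun x _ =>
      Nat.le_of_dvd (orderOf_pos x) (orderOf_map_dvd (QuotientGroup.mk' N) x)
  have hc := Subgroup.card_eq_card_quotient_mul_card_subgroup N
  have hpos : 0 < Nat.card N := Nat.card_pos
  rw [hc] at h
  refine Nat.lt_of_mul_lt_mul_left (a := Nat.card N) ?_
  linarith

theorem psi_congr {H : Type*} [Group H] [Finite G] (e : G ≃* H) : psi G = psi H := by
  have := Fintype.ofFinite G
  have := Fintype.ofEquiv G e.toEquiv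
  rw [psi_eq_sum, psi_eq_sum, ← Equiv.sum_comp e.toEquiv]
  exact Finset.sum_congr rfl fun x _ => (MulEquiv.orderOf_eq e x).symm

/-- If `x` centralizes `N` of prime order `p`, and its order modulo `N` is prime to `p`, then the
coset `xN` contains at most one element of order less than `p` times the order of `x` modulo `N`. -/
theorem coset_sum_ge [Finite G] {N : Subgroup G} [N.Normal] [Fintype N] {p : ℕ}
    (hp : p.Prime) (hN : Nat.card N = p) {x : G} (hx : ∀ z ∈ N, x * z = z * x)
    (hcop : (orderOf (x : G ⧸ N)).Coprime p) {e : ℕ} (he : e ≤ orderOf (x : G ⧸ N)) :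
    e * (1 + p * (p - 1)) ≤ ∑ n : N, orderOf (x * n) := by
  classical
  set d := orderOf (x : G ⧸ N) with hd
  have hmk (n : N) : ((x * n : G) : G ⧸ N) = (x : G ⧸ N) := by simp
  have hdvd (n : N) : d ∣ orderOf (x * n : G) := by
    have := orderOf_map_dvd (QuotientGroup.mk' N) (x * n : G)
    rwa [QuotientGroup.mk'_apply, hmk] at this
  have hdpos : 0 < d := orderOf_pos _
  have hlow (n : N) : d ≤ orderOf (x * n : G) := Nat.le_of_dvd (orderOf_pos _) (hdvd n)
  have hpow (n : N) : (x * n : G) ^ d ∈ N := by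
    rw [← QuotientGroup.eq_one_iff, QuotientGroup.mk_pow, hmk, hd, pow_orderOf_eq_one]
  have hhigh (n : N) (hn : (x * n : G) ^ d ≠ 1) : d * p ≤ orderOf (x * n : G) := by
    have h1 := orderOf_pow_of_dvd hdpos.ne' (hdvd n)
    have h2 : orderOf ((x * n : G) ^ d) = p := by
      refine orderOf_eq_prime ?_ hn (hp := ⟨hp⟩)
      have := pow_card_eq_one' (G := N) (x := ⟨_, hpow n⟩)
      rw [hN] at this
      simpa using congrArg Subtype.val this
    rw [h2] at h1
    rw [h1, Nat.mul_div_cancel' (hdvd n)]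
  have huniq : ∃ n₀ : N, ∀ n : N, n ≠ n₀ → (x * n : G) ^ d ≠ 1 := by
    by_cases hex : ∃ n₀ : N, (x * n₀ : G) ^ d = 1
    · obtain ⟨n₀, h0⟩ := hex
      refine ⟨n₀, fun n hne h => hne ?_⟩
      rw [Commute.mul_pow (hx n n.2)] at h
      rw [Commute.mul_pow (hx n₀ n₀.2)] at h0
      have h1 : n ^ d = n₀ ^ d := by
        apply Subtype.ext
        simpa using mul_left_cancel (h.trans h0.symm)
      refine (Nat.Coprime.pow_left_bijective (G := N) (n := d) ?_).1 h1
      rw [hN]; exact hcop.symm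
    · push Not at hex
      exact ⟨1, fun n _ => hex n⟩
  obtain ⟨n₀, h0⟩ := huniq
  rw [← Finset.add_sum_erase _ _ (Finset.mem_univ n₀)]
  have hsum : (p - 1) * (d * p) ≤ ∑ n ∈ Finset.univ.erase n₀, orderOf (x * n : G) := by
    have := Finset.card_nsmul_le_sum (Finset.univ.erase n₀) (fun n : N => orderOf (x * n : G))
      (d * p) (fun n hn => hhigh n (h0 n (Finset.ne_of_mem_erase hn)))
    rwa [Finset.card_erase_of_mem (Finset.mem_univ _), Finset.card_univ,
      ← Nat.card_eq_fintype_card, hN, smul_eq_mul] at this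
  calc e * (1 + p * (p - 1)) ≤ d * (1 + p * (p - 1)) := Nat.mul_le_mul_right _ he
    _ = d + (p - 1) * (d * p) := by ring
    _ ≤ _ := add_le_add (hlow n₀) hsum

end OrderSums

section Classification

open scoped commutatorElement

variable {G : Type*} [Group G]

/-- `G` has an elementary abelian `3`-subgroup of index `2`, with only involutions outside it. -/
def IsDihedralOverThree (G : Type*) [Group G] : Prop :=
  ∃ (m : ℕ) (K : Subgroup G), 1 ≤ m ∧ Nat.card K = 3 ^ m ∧ K.index = 2 ∧
    (∀ x ∈ K, x ^ 3 = 1) ∧ ∀ x ∉ K, x ^ 2 = 1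

/-- The possible shapes of a supersolvable group of average order below `31 / 12`. -/
def IsLowShape (G : Type*) [Group G] : Prop :=
  (∃ k : ℕ, Nat.card G = 2 ^ k) ∨ Nat.card G = 3 ∨ IsDihedralOverThree G

theorem IsLowShape.of_equiv {H : Type*} [Group H] (e : G ≃* H) (h : IsLowShape G) :
    IsLowShape H := by
  have hc : Nat.card H = Nat.card G := (Nat.card_congr e.toEquiv).symm
  rcases h with h | h | ⟨m, K, hm, hK, hi, h3, h2⟩
  · exact Or.inl (hc ▸ h)
  · exact Or.inr (Or.inl (hc ▸ h))
  · refine Or.inr (Or.inr ⟨m, K.comap e.symm.toMonoidHom, hm, ?_, ?_, ?_, ?_⟩)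
    · have := Subgroup.card_mul_index (K.comap e.symm.toMonoidHom)
      rw [Subgroup.index_comap_of_surjective K e.symm.surjective, hi, hc,
        ← Subgroup.card_mul_index K, hi] at this
      omega
    · rw [Subgroup.index_comap_of_surjective K e.symm.surjective, hi]
    · intro x hx
      have := h3 _ hx
      apply e.symm.injective
      simpa using this
    · intro x hx
      have := h2 _ hx
      apply e.symm.injective
      simpa using this

/-- A subgroup with only involutions outside it is inverted by these involutions, hence
commutative. -/
theorem mul_comm_of_involutions_outside {K : Subgroup G} {t : G} (ht : t ∉ K)
    (h : ∀ x ∉ K, x ^ 2 = 1) {x y : G} (hx : x ∈ K) (hy : y ∈ K) : x * y = y * x := by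
  have key : ∀ k ∈ K, t * k * t = k⁻¹ := by
    intro k hk
    have h1 := h (t * k) (fun hmem => ht ((Subgroup.mul_mem_cancel_right K hk).mp hmem))
    rw [pow_two] at h1
    exact eq_inv_of_mul_eq_one_left (by rw [← h1]; group)
  have ht2 : t * t = 1 := by rw [← pow_two]; exact h t ht
  have h1 := key (x * y) (K.mul_mem hx hy)
  have h2 : t * (x * y) * t = (t * x * t) * (t * y * t) := by
    calc t * (x * y) * t = t * x * 1 * y * t := by group
      _ = t * x * (t * t) * y * t := by rw [ht2]
      _ = _ := by group
  rw [h2, key x hx, key y hy, ← mul_inv_rev, inv_inj] at h1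
  exact h1.symm

theorem exists_notMem_of_index_two {K : Subgroup G} (hi : K.index = 2) : ∃ t, t ∉ K := by
  by_contra! h
  rw [(Subgroup.eq_top_iff' K).mpr h, Subgroup.index_top] at hi
  omega

theorem IsDihedralOverThree.clauseC [Finite G] (h : IsDihedralOverThree G) : ClauseC G := by
  have := Fintype.ofFinite G
  obtain ⟨m, K, hm, hK, hi, h3, h2⟩ := h
  obtain ⟨t, ht⟩ := exists_notMem_of_index_two hi
  have o3 : ∀ x ∈ K, x ≠ 1 → orderOf x = 3 := fun x hx h1 => orderOf_eq_prime (h3 x hx) h1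
  have o2 : ∀ x ∉ K, orderOf x = 2 := fun x hx =>
    orderOf_eq_prime (h2 x hx) (fun h => hx (h ▸ K.one_mem))
  refine ⟨m, K, hm, Subgroup.normal_of_index_eq_two hi, hK, hi,
    fun x hx y hy => mul_comm_of_involutions_outside ht h2 hx hy, o3, o2, ?_⟩
  have hG : Nat.card G = 3 ^ m * 2 := by rw [← Subgroup.card_mul_index K, hK, hi]
  have hpsi : (psi G : ℤ) = 5 * 3 ^ m - 2 := by
    classical
    have hcard (H : Subgroup G) : (Nat.card H : ℤ) = ∑ x : G, if x ∈ H then (1 : ℤ) else 0 := by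
      rw [Finset.sum_boole, Nat.card_eq_fintype_card, Fintype.card_subtype]
    have hform : ∀ x : G, (orderOf x : ℤ) =
        2 + (if x ∈ K then 1 else 0) - 2 * (if x ∈ (⊥ : Subgroup G) then 1 else 0) := by
      intro x
      by_cases h1 : x = 1
      · simp [h1, K.one_mem]
      · by_cases hx : x ∈ K
        · simp [h1, hx, o3 x hx h1]
        · simp [h1, hx, o2 x hx]
    rw [psi_eq_sum, Nat.cast_sum, Finset.sum_congr rfl (fun x _ => hform x),
      Finset.sum_sub_distrib, Finset.sum_add_distrib, ← Finset.mul_sum, ← hcard, ← hcard, hK,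
      Finset.sum_const, Finset.card_univ, ← Nat.card_eq_fintype_card, hG, Subgroup.card_bot]
    push_cast
    rw [nsmul_eq_mul]
    push_cast
    ring
  have hpsi' : (psi G : ℚ) = 5 * 3 ^ m - 2 := by exact_mod_cast hpsi
  rw [avgOrder, hpsi', hG]
  push_cast
  rw [mul_comm (2 : ℚ)]

/-- If all squares lie in `G'`, a subgroup containing `G'` and maximal among those avoiding a given
element is a maximal subgroup; hence `Φ(G) ≤ G'`. -/
theorem frattini_le_commutator [Finite G] (hsq : ∀ x : G, x ^ 2 ∈ commutator G) :
    frattini G ≤ commutator G := by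
  intro y hy
  by_contra hyc
  obtain ⟨M, hM⟩ := (Set.toFinite {M : Subgroup G | commutator G ≤ M ∧ y ∉ M}).exists_maximal
    ⟨commutator G, le_rfl, hyc⟩
  obtain ⟨hcM, hyM⟩ := hM.prop
  have hnorm : M.Normal := by
    constructor
    intro n hn g
    have h1 : ⁅g, n⁆ ∈ M :=
      hcM (Subgroup.commutator_mem_commutator (Subgroup.mem_top g) (Subgroup.mem_top n))
    have h2 : g * n * g⁻¹ = ⁅g, n⁆ * n := by rw [commutatorElement_def]; group
    rw [h2]
    exact M.mul_mem h1 hn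
  have hmax : ∀ L : Subgroup G, M < L → y ∈ L := by
    intro L hL
    by_contra hyL
    exact hL.not_ge (hM.le_of_ge ⟨hcM.trans hL.le, hyL⟩ hL.le)
  have hco : IsCoatom M := by
    refine ⟨fun h => hyM (h ▸ Subgroup.mem_top y), fun L hL => ?_⟩
    have hyL := hmax L hL
    rw [Subgroup.eq_top_iff']
    intro g
    by_cases hg : g ∈ M
    · exact hL.le hg
    have h1 : y ∈ M ⊔ Subgroup.zpowers g :=
      hmax _ (lt_of_le_of_ne le_sup_left fun h =>
        hg (h ▸ (le_sup_right : _ ≤ M ⊔ Subgroup.zpowers g) (Subgroup.mem_zpowers g)))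
    obtain ⟨a, ha, b, hb, rfl⟩ := Subgroup.mem_sup_of_normal_left.mp h1
    obtain ⟨k, rfl⟩ := Subgroup.mem_zpowers_iff.mp hb
    have hsqM : ∀ j : ℤ, g ^ (2 * j) ∈ M := by
      intro j
      rw [zpow_mul]
      exact M.zpow_mem (hcM (by exact_mod_cast hsq g)) j
    have hgk : g ^ k ∈ L := (Subgroup.mul_mem_cancel_left L (hL.le ha)).mp hyL
    rcases Int.even_or_odd' k with ⟨j, rfl | rfl⟩
    · exact absurd (M.mul_mem ha (hsqM j)) hyM
    · rw [zpow_add, zpow_one] at hgk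
      exact (Subgroup.mul_mem_cancel_left L (hL.le (hsqM j))).mp hgk
  exact hyM (frattini_le_coatom hco hy)

theorem commutator_le_frattini [Finite G] [Group.IsNilpotent G] :
    commutator G ≤ frattini G := by
  rw [frattini, Order.radical]
  refine le_iInf₂ fun M hM => ?_
  have hnorm : M.Normal :=
    Subgroup.NormalizerCondition.normal_of_coatom M Group.normalizerCondition_of_isNilpotent hM
  rw [commutator_def, Subgroup.commutator_le]
  obtain ⟨x, hx⟩ : ∃ x, x ∉ M := by
    by_contra! h
    exact hM.1 ((Subgroup.eq_top_iff' M).mpr h)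
  have htop : M ⊔ Subgroup.zpowers x = ⊤ :=
    hM.2 _ (lt_of_le_of_ne le_sup_left fun h =>
        hx (h ▸ (le_sup_right : _ ≤ M ⊔ Subgroup.zpowers x) (Subgroup.mem_zpowers x)))
  have hgen : ∀ g : G, ∃ k : ℤ, (g : G ⧸ M) = (x : G ⧸ M) ^ k := by
    intro g
    have hg : g ∈ M ⊔ Subgroup.zpowers x := htop ▸ Subgroup.mem_top g
    obtain ⟨a, ha, b, hb, rfl⟩ := Subgroup.mem_sup_of_normal_left.mp hg
    obtain ⟨k, rfl⟩ := Subgroup.mem_zpowers_iff.mp hb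
    exact ⟨k, by rw [QuotientGroup.mk_mul, (QuotientGroup.eq_one_iff a).mpr ha, one_mul,
      QuotientGroup.mk_zpow]⟩
  intro g _ h _
  obtain ⟨a, ha⟩ := hgen g
  obtain ⟨b, hb⟩ := hgen h
  rw [← QuotientGroup.eq_one_iff, commutatorElement_def, QuotientGroup.mk_mul,
    QuotientGroup.mk_mul, QuotientGroup.mk_mul, QuotientGroup.mk_inv, QuotientGroup.mk_inv, ha, hb]
  group

/-- In a `2`-group of small average order, all squares lie in the commutator subgroup. -/
theorem sq_mem_commutator [Finite G] {k : ℕ} (hk : Nat.card G = 2 ^ k)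
    (h : 12 * psi G < 31 * Nat.card G) (x : G) : x ^ 2 ∈ commutator G := by
  have := Fintype.ofFinite G
  let f : G →* Abelianization G := (powMonoidHom 2).comp Abelianization.of
  have hf : ∀ y, y ∈ f.ker ↔ y ^ 2 ∈ commutator G := by
    intro y
    rw [MonoidHom.mem_ker, ← Abelianization.ker_of, MonoidHom.mem_ker, map_pow]
    rfl
  by_contra hx
  have hne : f.ker.index ≠ 1 := fun h1 => hx <| by
    rw [← hf, Subgroup.index_eq_one.mp h1]; trivial
  have hlay := layered_sum_le (bot_le : ⊥ ≤ f.ker) (fun x => orderOf x) 1 2 4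
    (fun x _ => orderOf_pos x)
    (fun x _ hx => two_le_orderOf fun h => hx (by simp [h]))
    (fun x hx => by
      have h2 : x ^ 2 ≠ 1 := fun h => hx ((hf x).mpr (h ▸ one_mem _))
      refine four_le_orderOf h2 fun h3 => h2 ?_
      have hc : x ^ 2 ^ k = 1 := by rw [← hk]; exact pow_card_eq_one'
      have h1 : orderOf x ∣ Nat.gcd 3 (2 ^ k) :=
        Nat.dvd_gcd (orderOf_dvd_of_pow_eq_one h3) (orderOf_dvd_of_pow_eq_one hc)
      have h4 : Nat.gcd 3 (2 ^ k) = 1 := Nat.Coprime.pow_right k (by norm_num)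
      rw [h4, Nat.dvd_one, orderOf_eq_one_iff] at h1
      rw [h1, one_pow])
  rw [← psi_eq_sum, Subgroup.card_bot] at hlay
  have hi : f.ker.index ≠ 0 := Subgroup.index_ne_zero_of_finite
  have hmul := Subgroup.card_mul_index f.ker
  have h2 : Nat.card f.ker * 2 ≤ Nat.card G := by
    rw [← hmul]; exact Nat.mul_le_mul_left _ (by omega)
  have hG2 : Nat.card G ≤ 2 := by
    push_cast at hlay
    omega
  have hx1 : x ^ Nat.card G = 1 := pow_card_eq_one'
  have hpos : 0 < Nat.card G := Nat.card_pos
  have : Nat.card G = 1 ∨ Nat.card G = 2 := by omega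
  rcases this with h1 | h1
  · rw [h1, pow_one] at hx1
    exact hx (by rw [hx1, one_pow]; exact one_mem _)
  · rw [h1] at hx1
    exact hx (by rw [hx1]; exact one_mem _)

theorem involution_count [Finite G] {k : ℕ} (hk : Nat.card G = 2 ^ k)
    (h : 12 * psi G < 31 * Nat.card G) :
    (nOrd G 2 : ℚ) > 17 / 24 * (Nat.card G : ℚ) - 3 / 2 := by
  classical
  have := Fintype.ofFinite G
  have hn : (nOrd G 2 : ℤ) = ∑ x : G, if orderOf x = 2 then (1 : ℤ) else 0 := by
    rw [nOrd, Finset.sum_boole, Nat.card_eq_fintype_card, Fintype.card_subtype]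
  have h1 : (1 : ℤ) = ∑ x : G, if x = 1 then (1 : ℤ) else 0 := by simp
  have hsum : (4 : ℤ) * Nat.card G - 2 * nOrd G 2 - 3 * 1 ≤ psi G := by
    have hG : (4 : ℤ) * Nat.card G = ∑ _x : G, (4 : ℤ) := by
      rw [Finset.sum_const, Finset.card_univ, nsmul_eq_mul, mul_comm, Nat.card_eq_fintype_card]
    rw [hn, h1, hG, Finset.mul_sum, Finset.mul_sum, ← Finset.sum_sub_distrib,
      ← Finset.sum_sub_distrib, psi_eq_sum, Nat.cast_sum]
    refine Finset.sum_le_sum fun x _ => ?_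
    by_cases hx1 : x = 1
    · simp [hx1]
    by_cases hx2 : orderOf x = 2
    · simp [hx2, hx1]
    · have : 4 ≤ orderOf x := by
        obtain ⟨j, -, hj⟩ := (Nat.dvd_prime_pow Nat.prime_two).mp (hk ▸ orderOf_dvd_natCard x)
        rcases j with _ | _ | j
        · exact absurd (orderOf_eq_one_iff.mp (by simpa using hj)) hx1
        · exact absurd (by simpa using hj) hx2
        · rw [hj, pow_add]
          have := Nat.one_le_two_pow (n := j)
          omega
      simp only [hx1, hx2, if_false]
      omega
  have hfin : (17 : ℤ) * Nat.card G - 36 < 24 * nOrd G 2 := by omega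
  have : (17 : ℚ) * Nat.card G - 36 < 24 * nOrd G 2 := by exact_mod_cast hfin
  linarith

theorem clauseA_of_low [Finite G] {k : ℕ} (hk : Nat.card G = 2 ^ k)
    (h : 12 * psi G < 31 * Nat.card G) : ClauseA G := by
  have : Fact (Nat.Prime 2) := ⟨Nat.prime_two⟩
  have : Group.IsNilpotent G := (IsPGroup.of_card hk).isNilpotent
  exact ⟨⟨k, hk⟩, le_antisymm commutator_le_frattini
    (frattini_le_commutator (sq_mem_commutator hk h)), involution_count hk h⟩

theorem clauseB_of_card [Finite G] (h : Nat.card G = 3) : ClauseB G := by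
  have : Fact (Nat.Prime 3) := ⟨Nat.prime_three⟩
  have : IsCyclic G := isCyclic_of_prime_card h
  exact ⟨mulEquivOfCyclicCardEq (by rw [h, Nat.card_eq_fintype_card]; rfl)⟩

theorem IsLowShape.exactly_one [Finite G] (hG : IsLowShape G)
    (h : 12 * psi G < 31 * Nat.card G) :
    (ClauseA G ∧ ¬ClauseB G ∧ ¬ClauseC G) ∨
    (¬ClauseA G ∧ ClauseB G ∧ ¬ClauseC G) ∨
    (¬ClauseA G ∧ ¬ClauseB G ∧ ClauseC G) := by
  have hB : ClauseB G → Nat.card G = 3 := by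
    rintro ⟨e⟩
    rw [Nat.card_congr e.toEquiv, Nat.card_eq_fintype_card]; rfl
  have hC : ClauseC G → ∃ m, 1 ≤ m ∧ Nat.card G = 3 ^ m * 2 := by
    rintro ⟨m, K, hm, -, hK, hi, -⟩
    exact ⟨m, hm, by rw [← Subgroup.card_mul_index K, hK, hi]⟩
  have hAB : ClauseA G → ClauseB G → False := by
    rintro ⟨⟨k, hk⟩, -⟩ hb
    have h3 : 3 ∣ 2 ^ k := by rw [← hk, hB hb]
    exact absurd (Nat.prime_three.dvd_of_dvd_pow h3) (by norm_num)
  have hAC : ClauseA G → ClauseC G → False := by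
    rintro ⟨⟨k, hk⟩, -⟩ hc
    obtain ⟨m, hm, hc⟩ := hC hc
    have h3 : 3 ∣ 2 ^ k := by
      rw [← hk, hc]
      exact (dvd_pow_self 3 (by omega)).mul_right 2
    exact absurd (Nat.prime_three.dvd_of_dvd_pow h3) (by norm_num)
  have hBC : ClauseB G → ClauseC G → False := by
    intro hb hc
    obtain ⟨m, hm, hc⟩ := hC hc
    have := hB hb
    omega
  have : ClauseA G ∨ ClauseB G ∨ ClauseC G := by
    rcases hG with ⟨k, hk⟩ | h3 | hd
    · exact Or.inl (clauseA_of_low hk h)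
    · exact Or.inr (Or.inl (clauseB_of_card h3))
    · exact Or.inr (Or.inr hd.clauseC)
  tauto

end Classification

section PrimeExtension

variable {G : Type*} [Group G]

/-- The elements acting on `N` by conjugation as the identity or as inversion. -/
def signSubgroup (N : Subgroup G) : Subgroup G where
  carrier := {x | (∀ z ∈ N, x * z * x⁻¹ = z) ∨ (∀ z ∈ N, x * z * x⁻¹ = z⁻¹)}
  one_mem' := Or.inl fun z _ => by simp
  mul_mem' := by
    have conj (x y z : G) : x * y * z * (x * y)⁻¹ = x * (y * z * y⁻¹) * x⁻¹ := by group
    rintro x y (hx | hx) (hy | hy)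
    · exact Or.inl fun z hz => by rw [conj, hy z hz, hx z hz]
    · exact Or.inr fun z hz => by rw [conj, hy z hz, hx _ (N.inv_mem hz)]
    · exact Or.inr fun z hz => by rw [conj, hy z hz, hx z hz]
    · exact Or.inl fun z hz => by rw [conj, hy z hz, hx _ (N.inv_mem hz), inv_inv]
  inv_mem' := by
    rintro x (hx | hx)
    · refine Or.inl fun z hz => ?_
      nth_rw 1 [← hx z hz]; group
    · refine Or.inr fun z hz => ?_
      have := hx _ (N.inv_mem hz)
      rw [inv_inv] at this
      nth_rw 1 [← this]; group

theorem sq_mem_centralizer_of_mem_sign {N : Subgroup G} {x : G} (hx : x ∈ signSubgroup N) :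
    x ^ 2 ∈ Subgroup.centralizer (N : Set G) := by
  rw [Subgroup.mem_centralizer_iff]
  intro z hz
  have conj : x ^ 2 * z * (x ^ 2)⁻¹ = x * (x * z * x⁻¹) * x⁻¹ := by rw [pow_two]; group
  have : x ^ 2 * z * (x ^ 2)⁻¹ = z := by
    rcases hx with hx | hx
    · rw [conj, hx z hz, hx z hz]
    · rw [conj, hx z hz, hx _ (N.inv_mem hz), inv_inv]
  exact (mul_inv_eq_iff_eq_mul.mp this).symm

theorem mem_centralizer_of_commute {N : Subgroup G} {p : ℕ} (hp : p.Prime)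
    (hN : Nat.card N = p) {x w : G} (hw : w ∈ N) (h1 : w ≠ 1) (hxw : x * w = w * x) :
    x ∈ Subgroup.centralizer (N : Set G) := by
  have : Fact p.Prime := ⟨hp⟩
  rw [Subgroup.mem_centralizer_iff]
  intro z hz
  have hmem : (⟨z, hz⟩ : N) ∈ Subgroup.zpowers (⟨w, hw⟩ : N) :=
    mem_zpowers_of_prime_card hN (fun h => h1 (congrArg Subtype.val h))
  obtain ⟨k, hk⟩ := Subgroup.mem_zpowers_iff.mp hmem
  have hk' : w ^ k = z := by simpa using congrArg Subtype.val hk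
  have hc : Commute x w := hxw
  rw [← hk']
  exact (hc.zpow_right k).symm

theorem le_centralizer_of_prime_card {N : Subgroup G} {p : ℕ} (hp : p.Prime)
    (hN : Nat.card N = p) : N ≤ Subgroup.centralizer (N : Set G) := by
  intro x hx
  by_cases h1 : x = 1
  · rw [h1]; exact one_mem _
  · exact mem_centralizer_of_commute hp hN hx h1 rfl

theorem sq_eq_one_of_notMem_centralizer {N : Subgroup G} {p : ℕ} (hp : p.Prime)
    (hN : Nat.card N = p) {x : G} (hx : x ∉ Subgroup.centralizer (N : Set G))
    (h2 : x ^ 2 ∈ N) : x ^ 2 = 1 := by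
  by_contra h
  exact hx (mem_centralizer_of_commute hp hN h2 h (pow_succ' x 2 ▸ pow_succ x 2))

theorem mem_sign_of_mem_centralizer {N : Subgroup G} {x : G}
    (hx : x ∈ Subgroup.centralizer (N : Set G)) : x ∈ signSubgroup N := by
  refine Or.inl fun z hz => ?_
  rw [← Subgroup.mem_centralizer_iff.mp hx z hz, mul_inv_cancel_right]

theorem mem_sign_of_sq {N : Subgroup G} [N.Normal] {p : ℕ} (hp : p.Prime)
    (hN : Nat.card N = p) {x : G} (hx : x ^ 2 ∈ Subgroup.centralizer (N : Set G)) :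
    x ∈ signSubgroup N := by
  by_cases hc : x ∈ Subgroup.centralizer (N : Set G)
  · exact mem_sign_of_mem_centralizer hc
  refine Or.inr fun z hz => ?_
  have hz' : x * z * x⁻¹ ∈ N := Subgroup.Normal.conj_mem ‹_› z hz x
  by_contra hne
  refine hc (mem_centralizer_of_commute hp hN (N.mul_mem hz' hz)
    (fun h => hne (eq_inv_of_mul_eq_one_left h)) ?_)
  have h1 : z * x ^ 2 = x ^ 2 * z := Subgroup.mem_centralizer_iff.mp hx z hz
  have h2 := Subgroup.mem_centralizer_iff.mp (le_centralizer_of_prime_card hp hN hz') z hz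
  calc x * (x * z * x⁻¹ * z) = x ^ 2 * z * x⁻¹ * z := by rw [pow_two]; group
    _ = z * (x * z * x⁻¹) * x := by
      rw [h2, ← h1]
      have : z * x ^ 2 * x⁻¹ * z = z * (x * z * x⁻¹) * x := by rw [pow_two]; group
      rw [this, h2]
    _ = x * z * x⁻¹ * z * x := by rw [h2]

theorem card_eq_card_quotient_mul {N : Subgroup G} {p : ℕ}
    (hN : Nat.card N = p) :
    Nat.card G = Nat.card (G ⧸ N) * p := by
  rw [← hN]; exact Subgroup.card_eq_card_quotient_mul_card_subgroup N

theorem pow_mem_of_quotient {N : Subgroup G} [N.Normal]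
    {x : G} {k : ℕ} (h : (x : G ⧸ N) ^ k = 1) : x ^ k ∈ N := by
  rwa [← QuotientGroup.eq_one_iff, QuotientGroup.mk_pow]

theorem sign_eq_top_of_two_group [Finite G] {N : Subgroup G} [N.Normal] {p : ℕ}
    (hp : p.Prime) (hN : Nat.card N = p) (hp2 : p ≠ 2) {k : ℕ}
    (hk : Nat.card (G ⧸ N) = 2 ^ k) (h : 12 * psi G < 31 * Nat.card G) :
    signSubgroup N = ⊤ := by
  have := Fintype.ofFinite G
  by_contra hne
  have hlay := layered_sum_le (bot_le : ⊥ ≤ signSubgroup N) (fun x => orderOf x) 1 2 4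
    (fun x _ => orderOf_pos x)
    (fun x _ hx => two_le_orderOf fun h => hx (by simp [h]))
    (fun x hx => by
      refine four_le_orderOf (fun h2 => hx (mem_sign_of_sq hp hN (h2 ▸ one_mem _)))
        fun h3 => hx (mem_sign_of_mem_centralizer (le_centralizer_of_prime_card hp hN ?_))
      have hc : (x : G ⧸ N) ^ 2 ^ k = 1 := by rw [← hk]; exact pow_card_eq_one'
      have h3' : (x : G ⧸ N) ^ 3 = 1 := by rw [← QuotientGroup.mk_pow, h3, QuotientGroup.mk_one]
      have h1 : orderOf (x : G ⧸ N) ∣ Nat.gcd 3 (2 ^ k) :=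
        Nat.dvd_gcd (orderOf_dvd_of_pow_eq_one h3') (orderOf_dvd_of_pow_eq_one hc)
      have h4 : Nat.gcd 3 (2 ^ k) = 1 := Nat.Coprime.pow_right k (by norm_num)
      rw [h4, Nat.dvd_one, orderOf_eq_one_iff] at h1
      exact (QuotientGroup.eq_one_iff x).mp h1)
  rw [← psi_eq_sum, Subgroup.card_bot] at hlay
  have hi : (signSubgroup N).index ≠ 0 := Subgroup.index_ne_zero_of_finite
  have hi1 : (signSubgroup N).index ≠ 1 := fun h1 => hne (Subgroup.index_eq_one.mp h1)
  have h2 : Nat.card (signSubgroup N) * 2 ≤ Nat.card G := by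
    rw [← Subgroup.card_mul_index (signSubgroup N)]; exact Nat.mul_le_mul_left _ (by omega)
  have hG := card_eq_card_quotient_mul hN
  have hpos : 0 < Nat.card (G ⧸ N) := Nat.card_pos
  have hp3 : 3 ≤ p := by have := hp.two_le; omega
  have : 3 ≤ Nat.card G := by rw [hG]; nlinarith
  push_cast at hlay
  omega

theorem index_centralizer_le_two {N : Subgroup G}
    (hs : signSubgroup N = ⊤) :
    (Subgroup.centralizer (N : Set G)).index = 1 ∨
      (Subgroup.centralizer (N : Set G)).index = 2 := by
  have hcent : ∀ x : G, (∀ z ∈ N, x * z * x⁻¹ = z) → x ∈ Subgroup.centralizer (N : Set G) :=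
    fun x hx => Subgroup.mem_centralizer_iff.mpr fun z hz =>
      (mul_inv_eq_iff_eq_mul.mp (hx z hz)).symm
  by_cases htop : ∀ x, x ∈ Subgroup.centralizer (N : Set G)
  · exact Or.inl (Subgroup.index_eq_one.mpr ((Subgroup.eq_top_iff' _).mpr htop))
  push Not at htop
  obtain ⟨t, ht⟩ := htop
  have hinv : ∀ x ∉ Subgroup.centralizer (N : Set G), ∀ z ∈ N, x * z * x⁻¹ = z⁻¹ := by
    intro x hx
    have hmem : x ∈ signSubgroup N := hs ▸ Subgroup.mem_top x
    rcases hmem with h | h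
    · exact absurd (hcent x h) hx
    · exact h
  refine Or.inr (Subgroup.index_eq_two_iff.mpr ⟨t, fun b => ?_⟩)
  by_cases hb : b ∈ Subgroup.centralizer (N : Set G)
  · exact Or.inr ⟨hb, fun h => ht ((Subgroup.mul_mem_cancel_left _ hb).mp h)⟩
  · refine Or.inl ⟨hcent _ fun z hz => ?_, hb⟩
    have conj : b * t * z * (b * t)⁻¹ = b * (t * z * t⁻¹) * b⁻¹ := by group
    rw [conj, hinv t ht z hz, hinv b hb _ (N.inv_mem hz), inv_inv]

theorem coset_sum_ge_of_forall {N : Subgroup G} {p : ℕ}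
    [Fintype N] (hN : Nat.card N = p) {x : G} {e : ℕ}
    (h : ∀ n ∈ N, e ≤ orderOf (x * n)) : e * p ≤ ∑ n : N, orderOf (x * n : G) := by
  have := Finset.card_nsmul_le_sum Finset.univ (fun n : N => orderOf (x * n : G)) e
    (fun n _ => h n n.2)
  rwa [Finset.card_univ, ← Nat.card_eq_fintype_card, hN, smul_eq_mul, mul_comm] at this

theorem commute_of_mem_centralizer {N : Subgroup G}
    {x : G} (hx : x ∈ Subgroup.centralizer (N : Set G)) :
    ∀ z ∈ N, x * z = z * x :=
  fun z hz => (Subgroup.mem_centralizer_iff.mp hx z hz).symm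

theorem isLowShape_of_two_group_quotient [Finite G] {N : Subgroup G} [N.Normal] {p : ℕ}
    (hp : p.Prime) (hN : Nat.card N = p) {k : ℕ}
    (hk : Nat.card (G ⧸ N) = 2 ^ k) (h : 12 * psi G < 31 * Nat.card G) : IsLowShape G := by
  have := Fintype.ofFinite G
  have := Fintype.ofFinite N
  have hG := card_eq_card_quotient_mul hN
  by_cases hp2 : p = 2
  · exact Or.inl ⟨k + 1, by rw [hG, hk, hp2, pow_succ]⟩
  have hs := sign_eq_top_of_two_group hp hN hp2 hk h
  have hle := le_centralizer_of_prime_card hp hN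
  have hp3 : 3 ≤ p := by have := hp.two_le; omega
  set D := Subgroup.centralizer (N : Set G) with hD
  have hcop : ∀ x : G, (orderOf (x : G ⧸ N)).Coprime p := fun x => by
    have h1 : (2 ^ k).Coprime p :=
      Nat.Coprime.pow_left k ((Nat.coprime_primes Nat.prime_two hp).mpr (Ne.symm hp2))
    exact Nat.Coprime.coprime_dvd_left (hk ▸ orderOf_dvd_natCard _) h1
  have hlay := layered_sum_le hle (fun x => ∑ n : N, orderOf (x * n : G))
    (1 * (1 + p * (p - 1))) (2 * (1 + p * (p - 1))) (2 * p)
    (fun x hx => coset_sum_ge hp hN (commute_of_mem_centralizer (hle hx)) (hcop x)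
      (orderOf_pos _))
    (fun x hx hxN => coset_sum_ge hp hN (commute_of_mem_centralizer hx) (hcop x)
      (two_le_orderOf fun h => hxN ((QuotientGroup.eq_one_iff x).mp h)))
    (fun x hx => coset_sum_ge_of_forall hN fun n hn => two_le_orderOf fun h1 =>
      hx ((Subgroup.mul_mem_cancel_right D (hle hn)).mp (h1 ▸ one_mem _)))
  rw [sum_coset_sums, hN] at hlay
  obtain ⟨c, hc⟩ : p ∣ Nat.card D := hN ▸ Subgroup.card_dvd_of_le hle
  have hcpos : 0 < c := Nat.pos_of_ne_zero fun h0 => by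
    rw [h0, mul_zero] at hc; exact Nat.card_pos.ne' hc
  have hidx := index_centralizer_le_two hs
  rw [← hD] at hidx
  have hmul := Subgroup.card_mul_index D
  have hsmall : p = 3 ∧ c = 1 := by
    obtain ⟨s, rfl⟩ : ∃ s, p = s + 3 := ⟨p - 3, by omega⟩
    obtain ⟨r, rfl⟩ : ∃ r, c = r + 1 := ⟨c - 1, by omega⟩
    have hps : s + 3 - 1 = s + 2 := by omega
    rw [hps, hc] at hlay
    rw [hc] at hmul
    have hG2 : Nat.card G ≤ 2 * ((s + 3) * (r + 1)) := by
      rcases hidx with h1 | h1 <;> rw [h1] at hmul <;> omega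
    push_cast at hlay
    zify at h hG2
    have hlow : (2 : ℤ) * (s + 3) * Nat.card G +
        (2 * (1 + (s + 3) * (s + 2)) - 2 * (s + 3)) * ((s + 3) * (r + 1)) -
        (1 + (s + 3) * (s + 2)) * (s + 3) ≤ (s + 3) * psi G := by linarith
    have hlow2 : (2 : ℤ) * Nat.card G +
        (2 * (1 + (s + 3) * (s + 2)) - 2 * (s + 3)) * (r + 1) -
        (1 + (s + 3) * (s + 2)) ≤ psi G := by
      refine le_of_mul_le_mul_left (a := ((s : ℤ) + 3)) ?_ (by positivity)
      linarith
    have hkey : (12 : ℤ) * ((2 * (1 + (s + 3) * (s + 2)) - 2 * (s + 3)) * (r + 1) -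
        (1 + (s + 3) * (s + 2))) < 14 * ((s + 3) * (r + 1)) := by linarith
    have hs0 : (0 : ℤ) ≤ s := by positivity
    have hr0 : (0 : ℤ) ≤ r := by positivity
    have hrs : (0 : ℤ) ≤ r * s := by positivity
    have hrss : (0 : ℤ) ≤ r * s * s := by positivity
    have hss : (0 : ℤ) ≤ s * s := by positivity
    have hlin : (12 : ℤ) * (s * s) + 22 * s + 54 * r + 82 * (r * s) + 24 * (r * s * s) < 30 := by
      linarith
    constructor
    · have : (s : ℤ) < 2 := by linarith
      have hs1 : s = 0 ∨ s = 1 := by omega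
      rcases hs1 with h0 | h0
      · omega
      · rw [h0] at hlin; push_cast at hlin; linarith
    · have : (r : ℤ) < 1 := by linarith
      omega
  obtain ⟨h3, h1⟩ := hsmall
  rw [h3, h1, mul_one] at hc
  rcases hidx with hi | hi
  · exact Or.inr (Or.inl (by rw [← hmul, hc, hi]))
  · have hDN : N = D := Subgroup.eq_of_le_of_card_ge hle (by rw [hc, hN, h3])
    refine Or.inr (Or.inr ⟨1, D, le_rfl, by rw [hc, pow_one], hi, fun x hx => ?_, fun x hx => ?_⟩)
    · have := pow_card_eq_one' (G := D) (x := ⟨x, hx⟩)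
      rw [hc] at this
      simpa using congrArg Subtype.val this
    · exact sq_eq_one_of_notMem_centralizer hp hN hx
        (by rw [hDN]; exact Subgroup.sq_mem_of_index_two hi x)

theorem centralizer_eq_top_of_card_two {N : Subgroup G} [N.Normal]
    (hN : Nat.card N = 2) :
    ∀ x, x ∈ Subgroup.centralizer (N : Set G) := by
  intro x
  obtain ⟨y, hy, huniq⟩ := (Nat.card_eq_two_iff' (1 : N)).mp hN
  have hy1 : (y : G) ≠ 1 := fun h => hy (Subtype.ext h)
  have hconj : x * y * x⁻¹ ∈ N := Subgroup.Normal.conj_mem ‹_› _ y.2 x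
  have h1 := huniq ⟨_, hconj⟩ (fun h => hy1 (by simpa using congrArg Subtype.val h))
  have h2 : x * y * x⁻¹ = y := congrArg Subtype.val h1
  exact mem_centralizer_of_commute Nat.prime_two hN y.2 hy1 (mul_inv_eq_iff_eq_mul.mp h2)

theorem not_low_of_card_three_quotient [Finite G] {N : Subgroup G} [N.Normal] {p : ℕ}
    (hp : p.Prime) (hN : Nat.card N = p)
    (hq : Nat.card (G ⧸ N) = 3) : ¬ 12 * psi G < 31 * Nat.card G := by
  intro h
  have := Fintype.ofFinite G
  have := Fintype.ofFinite N
  have hG := card_eq_card_quotient_mul hN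
  rw [hq] at hG
  by_cases hp2 : p = 2
  · subst hp2
    have hcent := centralizer_eq_top_of_card_two hN
    have hord : ∀ x : G, orderOf (x : G ⧸ N) ∣ 3 := fun x => hq ▸ orderOf_dvd_natCard _
    have hcop : ∀ x : G, (orderOf (x : G ⧸ N)).Coprime 2 := fun x =>
      Nat.Coprime.coprime_dvd_left (hord x) (by norm_num)
    have hlay := layered_sum_le (le_refl N) (fun x => ∑ n : N, orderOf (x * n : G))
      (1 * (1 + 2 * (2 - 1))) 0 (3 * (1 + 2 * (2 - 1)))
      (fun x hx => coset_sum_ge hp hN (commute_of_mem_centralizer (hcent x)) (hcop x)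
        (orderOf_pos _))
      (fun x hx hxN => absurd hx hxN)
      (fun x hx => coset_sum_ge hp hN (commute_of_mem_centralizer (hcent x)) (hcop x) (by
        rcases (Nat.dvd_prime Nat.prime_three).mp (hord x) with h1 | h1
        · exact absurd ((QuotientGroup.eq_one_iff x).mp (orderOf_eq_one_iff.mp h1)) hx
        · exact h1.ge))
    rw [sum_coset_sums, hN, hG] at hlay
    rw [hG] at h
    push_cast at hlay
    omega
  · have hp3 : 3 ≤ p := by have := hp.two_le; omega
    have hlay := layered_sum_le (le_refl (⊥ : Subgroup G)) (fun x => orderOf x) 1 0 3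
      (fun x _ => orderOf_pos x) (fun x hx hxN => absurd hx hxN)
      (fun x hx => by
        have h2 : 2 ≤ orderOf x := two_le_orderOf fun h => hx (by simp [h])
        have h3 : orderOf x ≠ 2 := fun h2 => by
          have hd := orderOf_dvd_natCard x
          rw [h2, hG, Nat.prime_two.dvd_mul] at hd
          rcases hd with hd | hd
          · omega
          · exact hp2 ((Nat.prime_dvd_prime_iff_eq Nat.prime_two hp).mp hd).symm
        omega)
    rw [← psi_eq_sum, Subgroup.card_bot] at hlay
    push_cast at hlay
    omega

theorem isLowShape_of_dihedral_quotient [Finite G] {N : Subgroup G} [N.Normal] {p : ℕ}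
    (hp : p.Prime) (hN : Nat.card N = p)
    (hq : IsDihedralOverThree (G ⧸ N)) (h : 12 * psi G < 31 * Nat.card G) :
    IsDihedralOverThree G := by
  have := Fintype.ofFinite G
  have := Fintype.ofFinite N
  obtain ⟨m, L, hm, hL, hi, h3, h2⟩ := hq
  set K := L.comap (QuotientGroup.mk' N) with hKdef
  have hmemK : ∀ x : G, x ∈ K ↔ (x : G ⧸ N) ∈ L := fun x => Iff.rfl
  have hKi : K.index = 2 := by
    rw [hKdef, Subgroup.index_comap_of_surjective L (QuotientGroup.mk'_surjective N), hi]
  have hG : Nat.card G = 3 ^ m * 2 * p := by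
    rw [card_eq_card_quotient_mul hN, ← Subgroup.card_mul_index L, hL, hi]
  have hK : Nat.card K = 3 ^ m * p := by
    have := Subgroup.card_mul_index K
    rw [hKi, hG] at this
    linarith
  have hM : 3 ≤ 3 ^ m := Nat.le_self_pow (by omega) 3
  have hNK : N ≤ K := fun x hx => by
    rw [hmemK, (QuotientGroup.eq_one_iff x).mpr hx]; exact one_mem _
  have hNC := le_centralizer_of_prime_card hp hN
  have hcube : ∀ x ∈ K, x ^ 3 ∈ N := fun x hx => pow_mem_of_quotient (h3 _ hx)
  have hsq : ∀ x ∉ K, x ^ 2 ∈ N := fun x hx => pow_mem_of_quotient (h2 _ hx)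
  obtain ⟨t, ht⟩ := exists_notMem_of_index_two hKi
  have hKC : K ≤ Subgroup.centralizer (N : Set G) := by
    intro x hx
    have htx : t * x ∉ K := fun hmem => ht ((Subgroup.mul_mem_cancel_right K hx).mp hmem)
    have hxs : x ∈ signSubgroup N :=
      (Subgroup.mul_mem_cancel_left _ (mem_sign_of_sq hp hN (hNC (hsq t ht)))).mp
        (mem_sign_of_sq hp hN (hNC (hsq _ htx)))
    have hx3 : x = x ^ 3 * (x ^ 2)⁻¹ := by group
    rw [hx3]
    exact mul_mem (hNC (hcube x hx)) (inv_mem (sq_mem_centralizer_of_mem_sign hxs))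
  have hord3 : ∀ x ∈ K, x ∉ N → orderOf (x : G ⧸ N) = 3 := fun x hx hxN =>
    orderOf_eq_prime (h3 _ hx) (fun h => hxN ((QuotientGroup.eq_one_iff x).mp h))
  have hord2 : ∀ x ∉ K, orderOf (x : G ⧸ N) = 2 := fun x hx =>
    orderOf_eq_prime (h2 _ hx) (fun h => hx (hNK ((QuotientGroup.eq_one_iff x).mp h)))
  have hord1 : ∀ x ∈ N, orderOf (x : G ⧸ N) = 1 := fun x hx =>
    orderOf_eq_one_iff.mpr ((QuotientGroup.eq_one_iff x).mpr hx)
  by_cases hp3 : p = 3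
  · subst hp3
    have hN3 : ∀ x ∈ N, x ^ 3 = 1 := fun x hx => by
      have := pow_card_eq_one' (G := N) (x := ⟨x, hx⟩)
      rw [hN] at this
      simpa using congrArg Subtype.val this
    by_cases hout : ∀ x ∉ K, x ^ 2 = 1
    · refine ⟨m + 1, K, by omega, by rw [hK, pow_succ], hKi, ?_, hout⟩
      by_contra! hexp
      obtain ⟨k, hk, hk3⟩ := hexp
      have h9 : ∀ x ∈ K, x ^ 3 ≠ 1 → orderOf x = 9 := fun x hx hx3 => by
        have : Fact (Nat.Prime 3) := ⟨Nat.prime_three⟩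
        have := orderOf_eq_prime_pow (x := x) (p := 3) (n := 1) (by simpa using hx3)
          (by have := hN3 _ (hcube x hx); rw [← pow_mul] at this; exact this)
        simpa using this
      have hlay := layered_sum_le (le_refl K) (fun x => orderOf x + orderOf (x * k)) 10 0 4
        (fun x hx => by
          by_cases hx3 : x ^ 3 = 1
          · have hxk : (x * k) ^ 3 ≠ 1 := by
              have hc : Commute x k := mul_comm_of_involutions_outside ht hout hx hk
              rw [hc.mul_pow, hx3, one_mul]
              exact hk3
            have h1 := h9 _ (K.mul_mem hx hk) hxk
            have h2 := orderOf_pos x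
            omega
          · have h1 := h9 x hx hx3
            have h2 := orderOf_pos (x * k)
            omega)
        (fun x hx hxN => absurd hx hxN)
        (fun x hx => by
          have h1 := two_le_orderOf (x := x) (fun h => hx (h ▸ one_mem K))
          have h2 := two_le_orderOf (x := x * k)
            (fun h => hx ((Subgroup.mul_mem_cancel_right K hk).mp (h ▸ one_mem K)))
          omega)
      rw [Finset.sum_add_distrib, ← psi_eq_sum,
        show ∑ x, orderOf (x * k) = ∑ x, orderOf x from
          Equiv.sum_comp (Equiv.mulRight k) (fun x => orderOf x), ← psi_eq_sum, hK, hG] at hlay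
      rw [hG] at h
      push_cast at hlay
      zify at h hM
      linarith
    · exfalso
      push Not at hout
      obtain ⟨s, hs, hs2⟩ := hout
      have hsC : s ∈ Subgroup.centralizer (N : Set G) := by
        by_contra hsC
        exact hs2 (sq_eq_one_of_notMem_centralizer hp hN hsC (hsq s hs))
      have hcent : ∀ x, x ∈ Subgroup.centralizer (N : Set G) := by
        intro x
        by_cases hx : x ∈ K
        · exact hKC hx
        · have hsx : s * x ∈ K :=
            (Subgroup.mul_mem_iff_of_index_two hKi).mpr (iff_of_false hs hx)
          exact (Subgroup.mul_mem_cancel_left _ hsC).mp (hKC hsx)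
      have hlay := layered_sum_le hNK (fun x => ∑ n : N, orderOf (x * n : G))
        (1 * (1 + 3 * (3 - 1))) (3 * 3) (2 * (1 + 3 * (3 - 1)))
        (fun x hx => coset_sum_ge hp hN (commute_of_mem_centralizer (hcent x))
          (by rw [hord1 x hx]; norm_num) (orderOf_pos _))
        (fun x hx hxN => coset_sum_ge_of_forall hN fun n hn => by
          have h1 := orderOf_map_dvd (QuotientGroup.mk' N) (x * n)
          rw [QuotientGroup.mk'_apply, QuotientGroup.mk_mul_of_mem x hn, hord3 x hx hxN] at h1
          exact Nat.le_of_dvd (orderOf_pos _) h1)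
        (fun x hx => coset_sum_ge hp hN (commute_of_mem_centralizer (hcent x))
          (by rw [hord2 x hx]; norm_num) (hord2 x hx).ge)
      rw [sum_coset_sums, hN, hK, hG] at hlay
      rw [hG] at h
      push_cast at hlay
      zify at h hM
      linarith
  · exfalso
    have hcop3 : (3 : ℕ).Coprime p := (Nat.coprime_primes Nat.prime_three hp).mpr (Ne.symm hp3)
    have hlay := layered_sum_le hNK (fun x => ∑ n : N, orderOf (x * n : G))
      (1 * (1 + p * (p - 1))) (3 * (1 + p * (p - 1))) (2 * p)
      (fun x hx => coset_sum_ge hp hN (commute_of_mem_centralizer (hNC hx))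
        (by rw [hord1 x hx]; exact Nat.coprime_one_left p) (orderOf_pos _))
      (fun x hx hxN => coset_sum_ge hp hN (commute_of_mem_centralizer (hKC hx))
        (by rw [hord3 x hx hxN]; exact hcop3) (hord3 x hx hxN).ge)
      (fun x hx => coset_sum_ge_of_forall hN fun n hn => two_le_orderOf fun h1 =>
        hx ((Subgroup.mul_mem_cancel_right K (hNK hn)).mp (h1 ▸ one_mem _)))
    rw [sum_coset_sums, hN, hK, hG] at hlay
    rw [hG] at h
    obtain ⟨s, rfl⟩ : ∃ s, p = s + 2 := ⟨p - 2, by have := hp.two_le; omega⟩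
    obtain ⟨M, hMe⟩ : ∃ M, 3 ^ m = M + 3 := ⟨3 ^ m - 3, by omega⟩
    have hps : s + 2 - 1 = s + 1 := by omega
    have hMz : (3 : ℤ) ^ m = M + 3 := by exact_mod_cast hMe
    rw [hps] at hlay
    rw [hMe] at h
    push_cast at hlay
    rw [hMz] at hlay
    zify at h
    have hlow : (2 : ℤ) * ((M + 3) * 2 * (s + 2)) +
        (3 * (1 + (s + 2) * (s + 1)) - 2 * (s + 2)) * (M + 3) -
        2 * (1 + (s + 2) * (s + 1)) ≤ psi G := by
      refine le_of_mul_le_mul_left (a := ((s : ℤ) + 2)) ?_ (by positivity)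
      linarith
    have hMs : (0 : ℤ) ≤ M * s := by positivity
    have hMss : (0 : ℤ) ≤ M * s * s := by positivity
    have hss : (0 : ℤ) ≤ s * s := by positivity
    linarith

/-- The possible shapes lift along quotients by normal subgroups of prime order. -/
theorem isLowShape_of_prime_quotient [Finite G] {N : Subgroup G} [N.Normal] {p : ℕ}
    (hp : p.Prime) (hN : Nat.card N = p)
    (hq : IsLowShape (G ⧸ N)) (h : 12 * psi G < 31 * Nat.card G) : IsLowShape G := by
  rcases hq with ⟨k, hk⟩ | h3 | hd
  · exact isLowShape_of_two_group_quotient hp hN hk h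
  · exact absurd h (not_low_of_card_three_quotient hp hN h3)
  · exact Or.inr (Or.inr (isLowShape_of_dihedral_quotient hp hN hd h))

end PrimeExtension

section Supersolvable

universe u

theorem isLowShape_of_cyclic_quotient {G : Type u} [Group G] [Finite G] (L : Subgroup G)
    [L.Normal] [IsCyclic L] (hL : IsLowShape (G ⧸ L)) (h : 12 * psi G < 31 * Nat.card G) :
    IsLowShape G := by
  induction hn : Nat.card G using Nat.strong_induction_on generalizing G with
  | _ n ih =>
  by_cases hbot : L = ⊥
  · subst hbot
    exact hL.of_equiv QuotientGroup.quotientBot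
  have hcard : Nat.card L ≠ 1 := fun h1 => hbot (Subgroup.card_eq_one.mp h1)
  obtain ⟨p, hp, hpd⟩ := Nat.exists_prime_and_dvd hcard
  have : Fact p.Prime := ⟨hp⟩
  obtain ⟨y, hy⟩ := exists_prime_orderOf_dvd_card' p hpd
  obtain ⟨g, hg⟩ := IsCyclic.exists_generator (α := L)
  have hNL : Subgroup.zpowers (y : G) ≤ L := by
    rw [Subgroup.zpowers_le]; exact y.2
  have hN : Nat.card (Subgroup.zpowers (y : G)) = p := by
    rw [Nat.card_zpowers, Subgroup.orderOf_coe, hy]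
  have hconj : ∀ x : G, x * y * x⁻¹ ∈ Subgroup.zpowers (y : G) := by
    intro x
    obtain ⟨j, hj⟩ := Subgroup.mem_zpowers_iff.mp (hg y)
    obtain ⟨k, hk⟩ := Subgroup.mem_zpowers_iff.mp
      (hg ⟨x * g * x⁻¹, Subgroup.Normal.conj_mem ‹_› _ g.2 x⟩)
    have hj' : (g : G) ^ j = y := by simpa using congrArg Subtype.val hj
    have hk' : (g : G) ^ k = x * g * x⁻¹ := by simpa using congrArg Subtype.val hk
    refine Subgroup.mem_zpowers_iff.mpr ⟨k, ?_⟩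
    rw [← hj', ← conj_zpow, ← hk', ← zpow_mul, ← zpow_mul, mul_comm]
  have hnorm : (Subgroup.zpowers (y : G)).Normal := by
    constructor
    intro z hz x
    obtain ⟨k, rfl⟩ := Subgroup.mem_zpowers_iff.mp hz
    rw [← conj_zpow]
    exact Subgroup.zpow_mem _ (hconj x) k
  have hlt : Nat.card (G ⧸ Subgroup.zpowers (y : G)) < n := by
    rw [← hn, card_eq_card_quotient_mul hN]
    exact lt_mul_of_one_lt_right Nat.card_pos hp.one_lt
  have hcyc : IsCyclic (L.map (QuotientGroup.mk' (Subgroup.zpowers (y : G)))) :=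
    isCyclic_of_surjective ((QuotientGroup.mk' (Subgroup.zpowers (y : G))).subgroupMap L)
      (MonoidHom.subgroupMap_surjective _ _)
  have hnormL : (L.map (QuotientGroup.mk' (Subgroup.zpowers (y : G)))).Normal :=
    Subgroup.Normal.map ‹_› _ (QuotientGroup.mk'_surjective _)
  exact isLowShape_of_prime_quotient hp hN
    (ih _ hlt (L.map (QuotientGroup.mk' (Subgroup.zpowers (y : G))))
      (hL.of_equiv (QuotientGroup.quotientQuotientEquivQuotient _ L hNL).symm)
      (low_quotient _ h) rfl) h

theorem isLowShape_of_supersolvable {G : Type u} [Group G] [Finite G] (hss : IsSupersolvable G)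
    (h : 12 * psi G < 31 * Nat.card G) : IsLowShape G := by
  obtain ⟨n, H, hnorm, h0, hlast, hle, hcyc⟩ := hss
  have key : ∀ i, IsLowShape (G ⧸ H i) := by
    intro i
    induction i using Fin.reverseInduction with
    | last =>
      refine Or.inl ⟨0, ?_⟩
      rw [hlast, pow_zero]
      exact Subgroup.index_top
    | cast i ih =>
      have := hnorm i.castSucc
      have := hnorm i.succ
      have := hcyc i
      have hnormL : ((H i.succ).map (QuotientGroup.mk' (H i.castSucc))).Normal :=
        Subgroup.Normal.map ‹_› _ (QuotientGroup.mk'_surjective _)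
      have hcycL : IsCyclic ((H i.succ).map (QuotientGroup.mk' (H i.castSucc))) := by
        refine isCyclic_of_surjective (QuotientGroup.lift ((H i.castSucc).subgroupOf (H i.succ))
          ((QuotientGroup.mk' (H i.castSucc)).subgroupMap (H i.succ)) ?_)
          (QuotientGroup.lift_surjective_of_surjective _ _
            (MonoidHom.subgroupMap_surjective _ _) _)
        intro x hx
        exact Subtype.ext ((QuotientGroup.eq_one_iff (x : G)).mpr hx)
      exact isLowShape_of_cyclic_quotient ((H i.succ).map (QuotientGroup.mk' (H i.castSucc)))
        (ih.of_equiv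
          (QuotientGroup.quotientQuotientEquivQuotient (H i.castSucc) (H i.succ) (hle i)).symm)
        (low_quotient _ h)
  have hbot := key 0
  have e : G ⧸ H 0 ≃* G :=
    (QuotientGroup.quotientMulEquivOfEq h0).trans QuotientGroup.quotientBot
  exact hbot.of_equiv e

end Supersolvable

/-- If a finite supersolvable group `G` satisfies `o(G) < 31/12`, then exactly one
of the clauses (a), (b), (c) holds. -/
theorem stmt_8 (G : Type*) [Group G] [Finite G] (hss : IsSupersolvable G)
    (h : avgOrder G < 31 / 12) :
    (ClauseA G ∧ ¬ClauseB G ∧ ¬ClauseC G) ∨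
    (¬ClauseA G ∧ ClauseB G ∧ ¬ClauseC G) ∨
    (¬ClauseA G ∧ ¬ClauseB G ∧ ClauseC G) := by
  have hlow := avgOrder_lt_iff.mp h
  exact (isLowShape_of_supersolvable hss hlow).exactly_one hlow
end

section
/- Let G be a finite group and let X be a non-trivial normal subgroup of G. Then o(G/X) < o(G). -/
/-- Summing the order of the image in `G ⧸ X` over `G` gives `|X| * ψ(G ⧸ X)`. -/
theorem sum_orderOf_mk (G : Type*) [Group G] [Fintype G] (X : Subgroup G) [X.Normal] :
    ∑ x : G, orderOf (x : G ⧸ X) = Nat.card X * psi (G ⧸ X) := by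
  classical
  have : Fintype (G ⧸ X) := Fintype.ofFinite _
  rw [psi, finsum_eq_sum_of_fintype, Finset.mul_sum,
    ← Finset.sum_fiberwise Finset.univ (fun x : G => (x : G ⧸ X))]
  refine Finset.sum_congr rfl fun q _ => ?_
  have hcard : (Finset.univ.filter fun x : G => (x : G ⧸ X) = q).card = Nat.card X := by
    have h := QuotientGroup.card_preimage_mk X {q}
    rw [Nat.card_unique (α := ({q} : Set (G ⧸ X))), mul_one] at h
    rw [← h, Nat.card_eq_fintype_card, Fintype.card_subtype]
    simp only [Set.mem_preimage, Set.mem_singleton_iff]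
  rw [← hcard, ← smul_eq_mul, ← Finset.sum_const]
  exact Finset.sum_congr rfl fun x hx => by rw [(Finset.mem_filter.1 hx).2]

theorem card_mul_psi_quotient_lt (G : Type*) [Group G] [Finite G] (X : Subgroup G) [X.Normal]
    (hX : X ≠ ⊥) : Nat.card X * psi (G ⧸ X) < psi G := by
  have : Fintype G := Fintype.ofFinite G
  obtain ⟨a, haX, ha⟩ := X.bot_or_exists_ne_one.resolve_left hX
  rw [← sum_orderOf_mk, psi, finsum_eq_sum_of_fintype]
  refine Finset.sum_lt_sum
    (fun x _ => Nat.le_of_dvd (orderOf_pos x) (orderOf_map_dvd (QuotientGroup.mk' X) x))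
    ⟨a, Finset.mem_univ a, ?_⟩
  rw [(QuotientGroup.eq_one_iff a).2 haX, orderOf_one]
  exact Nat.lt_of_le_of_ne (orderOf_pos a) (Ne.symm (mt orderOf_eq_one_iff.1 ha))

/-- If `X` is a non-trivial normal subgroup of a finite group `G`, then
`o(G/X) < o(G)`. -/
theorem stmt_10 (G : Type*) [Group G] [Finite G] (X : Subgroup G) [X.Normal]
    (hX : X ≠ ⊥) :
    avgOrder (G ⧸ X) < avgOrder G := by
  have hlt := card_mul_psi_quotient_lt G X hX
  have hQ : (0 : ℚ) < Nat.card (G ⧸ X) := by exact_mod_cast Nat.card_pos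
  have hX' : (0 : ℚ) < Nat.card X := by exact_mod_cast Nat.card_pos
  rw [avgOrder, avgOrder, X.card_eq_card_quotient_mul_card_subgroup, Nat.cast_mul,
    div_lt_div_iff₀ hQ (mul_pos hQ hX')]
  have hlt' : (Nat.card X * psi (G ⧸ X) : ℚ) < psi G := by exact_mod_cast hlt
  calc (psi (G ⧸ X) : ℚ) * (Nat.card (G ⧸ X) * Nat.card X)
      = Nat.card X * psi (G ⧸ X) * Nat.card (G ⧸ X) := by ring
    _ < psi G * Nat.card (G ⧸ X) := by gcongr
end

section
/- Let G be a finite group with o(G) = 31/12. Then |G| = 4n where n is an odd positive integer divisible by 3; in particular, 12 divides |G| and |G|/4 is odd. -/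
/-- The sum of the element orders of a finite group is odd: inversion pairs off the elements
of order greater than two, and elements of order two contribute an even amount. -/
theorem odd_psi (G : Type*) [Group G] [Finite G] : Odd (psi G) := by
  classical
  have := Fintype.ofFinite G
  rw [psi, finsum_eq_sum_of_fintype, ← ZMod.natCast_eq_one_iff_odd, Nat.cast_sum,
    ← Finset.add_sum_erase _ _ (Finset.mem_univ (1 : G)), orderOf_one, Nat.cast_one,
    add_eq_left]
  refine Finset.sum_involution (fun g _ => g⁻¹) (fun g _ => ?_) (fun g hg hne hinv => hne ?_)
    (fun g hg => ?_) (fun g _ => inv_inv g)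
  · rw [orderOf_inv, CharTwo.add_self_eq_zero]
  · have hsq : g ^ 2 = 1 := by rw [sq, ← inv_eq_iff_mul_eq_one, hinv]
    rw [orderOf_eq_prime hsq (Finset.ne_of_mem_erase hg)]
    rfl
  · simpa using hg

/-- If a finite group `G` satisfies `o(G) = 31/12`, then `|G| = 4n` with `n` odd and
divisible by `3`; in particular `12 ∣ |G|` and `|G|/4` is odd. -/
theorem stmt_12 (G : Type*) [Group G] [Finite G] (h : avgOrder G = 31 / 12) :
    (∃ n : ℕ, 0 < n ∧ Odd n ∧ 3 ∣ n ∧ Nat.card G = 4 * n) ∧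
      12 ∣ Nat.card G ∧ Odd (Nat.card G / 4) := by
  have hpos : 0 < Nat.card G := Nat.card_pos
  have hcard : 12 * psi G = 31 * Nat.card G := by
    have hne : (Nat.card G : ℚ) ≠ 0 := by exact_mod_cast hpos.ne'
    rw [avgOrder, div_eq_div_iff hne (by norm_num)] at h
    rw [mul_comm]
    exact_mod_cast h
  obtain ⟨k, hk⟩ := odd_psi G
  generalize Nat.card G = c at hpos hcard ⊢
  obtain ⟨m, rfl⟩ : ∃ m, c = 12 * m := ⟨c / 12, by omega⟩
  have hm : Odd m := by
    rw [Nat.odd_iff]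
    omega
  have hquot : 12 * m / 4 = 3 * m := by omega
  have hodd : Odd (3 * m) := Nat.odd_mul.2 ⟨by decide, hm⟩
  exact ⟨⟨3 * m, by omega, hodd, dvd_mul_right 3 m, by ring⟩, dvd_mul_right 12 m,
    hquot ▸ hodd⟩
end

section
/- Every finite group G of order 12 that is not isomorphic to the alternating group A_4 satisfies o(G) > 31/12; equivalently, A_4 is the unique group of order 12 whose average order is at most 31/12. -/
theorem psi_eq_of_mulEquiv {G H : Type*} [Group G] [Group H] (e : G ≃* H) : psi G = psi H := by
  rw [psi, psi, ← finsum_comp_equiv e.toEquiv]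
  exact finsum_congr fun x => (orderOf_injective e.toMonoidHom e.injective x).symm

theorem psi_alternatingGroup_fin_four_le : psi (alternatingGroup (Fin 4)) ≤ 31 := by
  rw [psi, finsum_eq_sum_of_fintype]
  have hpow : ∀ x : alternatingGroup (Fin 4), x ^ 2 = 1 ∨ x ^ 3 = 1 := by decide
  calc ∑ x : alternatingGroup (Fin 4), orderOf x
      ≤ ∑ x : alternatingGroup (Fin 4), if x = 1 then 1 else if x ^ 2 = 1 then 2 else 3 := by
        refine Finset.sum_le_sum fun x _ => ?_
        split_ifs with h1 h2
        · simp [h1]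
        · exact orderOf_le_of_pow_eq_one two_pos h2
        · exact orderOf_le_of_pow_eq_one three_pos ((hpow x).resolve_left h2)
    _ ≤ 31 := by decide

theorem lt_psi_of_orderOf_eq_six {G : Type*} [Group G] [Finite G] (hcard : Nat.card G = 12)
    {b : G} (hb : orderOf b = 6) : 31 < psi G := by
  classical
  have := Fintype.ofFinite G
  rw [psi, finsum_eq_sum_of_fintype]
  have ho (k : ℕ) (hk : k ≠ 0) : orderOf (b ^ k) = 6 / Nat.gcd 6 k := by
    rw [orderOf_pow' b hk, hb]
  have h2 : orderOf (b ^ 2) = 3 := ho 2 (by norm_num)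
  have h4 : orderOf (b ^ 4) = 3 := ho 4 (by norm_num)
  have h5 : orderOf (b ^ 5) = 6 := ho 5 (by norm_num)
  have hne : b ^ 2 ≠ b ^ 4 := fun h => by
    have := pow_inj_mod.1 h
    rw [hb] at this
    omega
  have hne' : b ≠ b ^ 5 := fun h => by
    have := pow_inj_mod.1 ((pow_one b).trans h)
    rw [hb] at this
    omega
  have key (x : G) : 2 + (if x = b ^ 2 then 1 else 0) + (if x = b ^ 4 then 1 else 0) +
      (if x = b then 4 else 0) + (if x = b ^ 5 then 4 else 0) ≤
      orderOf x + if x = 1 then 1 else 0 := by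
    have h1 : x = 1 → orderOf x = 1 := fun h => by simp [h]
    have hpos := orderOf_pos x
    have h1' : orderOf x = 1 → x = 1 := orderOf_eq_one_iff.1
    grind
  have hsum := Finset.sum_le_sum fun x (_ : x ∈ Finset.univ) => key x
  simp only [Finset.sum_add_distrib, Finset.sum_ite_eq', Finset.mem_univ, if_true,
    Finset.sum_const, Finset.card_univ, ← Nat.card_eq_fintype_card, hcard, smul_eq_mul] at hsum
  omega

theorem exists_orderOf_eq_six {G : Type*} [Group G] [Finite G] (hcard : Nat.card G = 12)
    {N : Subgroup G} [N.Normal] (hN : Nat.card N = 3) : ∃ b : G, orderOf b = 6 := by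
  have : Fact (Nat.Prime 3) := ⟨Nat.prime_three⟩
  have : Fact (Nat.Prime 2) := ⟨Nat.prime_two⟩
  have : IsCyclic N := isCyclic_of_prime_card hN
  let f : G →* MulAut N := MulAut.conjNormal
  have hrange : Nat.card f.range ∣ 2 := by
    have h := IsCyclic.card_mulAut (G := N)
    rw [hN, Nat.totient_prime Nat.prime_three] at h
    exact f.range.card_subgroup_dvd_card.trans h.dvd
  have hker : 2 ∣ Nat.card f.ker := by
    have h := f.ker.card_mul_index
    rw [Subgroup.index_ker, hcard] at h
    rcases (Nat.dvd_prime Nat.prime_two).1 hrange with h' | h' <;> rw [h'] at h <;> omega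
  obtain ⟨z, hz⟩ := exists_prime_orderOf_dvd_card' 2 hker
  obtain ⟨a, ha⟩ := exists_prime_orderOf_dvd_card' 3 hN.symm.dvd
  rw [← Subgroup.orderOf_coe] at hz ha
  have hcomm : Commute (z : G) a := by
    have h := congrArg Subtype.val (DFunLike.congr_fun (f.mem_ker.1 z.2) a)
    rw [MulAut.conjNormal_apply] at h
    exact mul_inv_eq_iff_eq_mul.1 h
  refine ⟨z * a, ?_⟩
  rw [hcomm.orderOf_mul_eq_mul_orderOf_of_coprime (by rw [hz, ha]; norm_num), hz, ha]

theorem nonempty_mulEquiv_alternatingGroup {G : Type*} [Group G] [Finite G]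
    (hcard : Nat.card G = 12) (h : ∀ N : Subgroup G, N.Normal → Nat.card N ≠ 3) :
    Nonempty (G ≃* alternatingGroup (Fin 4)) := by
  have : Fact (Nat.Prime 3) := ⟨Nat.prime_three⟩
  let P : Sylow 3 G := default
  have hP : Nat.card P = 3 := by
    rw [P.card_eq_multiplicity, hcard, Nat.factorization_def _ Nat.prime_three,
      show 12 = 3 * 4 from rfl, padicValNat.mul (by norm_num) (by norm_num), padicValNat_self,
      padicValNat.eq_zero_of_not_dvd (by norm_num)]
    rfl
  have hPn : ¬ (P : Subgroup G).Normal := fun hn => h P hn hP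
  have hidx : (P : Subgroup G).index = 4 := by
    have := (P : Subgroup G).card_mul_index
    rw [hcard] at this
    have hP' : Nat.card (P : Subgroup G) = 3 := hP
    rw [hP'] at this
    omega
  have hsyl : Nat.card (Sylow 3 G) = 4 := by
    have hdvd := P.card_dvd_index
    have hmod := card_sylow_modEq_one 3 G
    have hne : Nat.card (Sylow 3 G) ≠ 1 := fun h1 => by
      have := (Nat.card_eq_one_iff_unique.1 h1).1
      exact hPn P.normal_of_subsingleton
    rw [hidx] at hdvd
    have := Nat.le_of_dvd (by norm_num) hdvd
    rw [Nat.ModEq] at hmod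
    omega
  have hstab : Nat.card (MulAction.stabilizer G P) = 3 := by
    have h1 := (MulAction.stabilizer G P).card_mul_index
    rw [MulAction.index_stabilizer_of_transitive, hsyl, hcard] at h1
    omega
  let e : Sylow 3 G ≃ Fin 4 := (Finite.equivFin _).trans (finCongr hsyl)
  let f : G →* Equiv.Perm (Fin 4) :=
    (e.permCongrHom : _ →* _).comp (MulAction.toPermHom G (Sylow 3 G))
  have hle : f.ker ≤ MulAction.stabilizer G P := fun g hg => by
    have : MulAction.toPermHom G (Sylow 3 G) g = 1 :=
      e.permCongrHom.injective (by simpa [f] using hg)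
    exact DFunLike.congr_fun this P
  have hker : f.ker = ⊥ := by
    have hdvd := Subgroup.card_dvd_of_le hle
    rw [hstab] at hdvd
    rw [Subgroup.eq_bot_iff_card]
    exact ((Nat.dvd_prime Nat.prime_three).1 hdvd).resolve_right (h _ inferInstance)
  have hinj : Function.Injective f := (MonoidHom.ker_eq_bot_iff f).1 hker
  have hrange : f.range = alternatingGroup (Fin 4) := by
    apply Equiv.Perm.eq_alternatingGroup_of_index_eq_two
    have h1 := f.range.card_mul_index
    rw [← Nat.card_congr (f.ofInjective hinj).toEquiv, hcard, Nat.card_perm, Nat.card_fin,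
      show Nat.factorial 4 = 24 from rfl] at h1
    omega
  exact ⟨(f.ofInjective hinj).trans (MulEquiv.subgroupCongr hrange)⟩

/-- Every group of order `12` not isomorphic to `A₄` has average order `> 31/12`;
equivalently, `A₄` is the unique group of order `12` with average order `≤ 31/12`. -/
theorem stmt_15 (G : Type*) [Group G] [Finite G] (hcard : Nat.card G = 12) :
    (¬Nonempty (G ≃* alternatingGroup (Fin 4)) → avgOrder G > 31 / 12) ∧
      (avgOrder G ≤ 31 / 12 ↔ Nonempty (G ≃* alternatingGroup (Fin 4))) := by
  have hle : Nonempty (G ≃* alternatingGroup (Fin 4)) → avgOrder G ≤ 31 / 12 := fun ⟨e⟩ => by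
    have : (psi G : ℚ) ≤ 31 := by
      exact_mod_cast (psi_eq_of_mulEquiv e).trans_le psi_alternatingGroup_fin_four_le
    rw [avgOrder, hcard]
    push_cast
    gcongr
  have hlt : ¬Nonempty (G ≃* alternatingGroup (Fin 4)) → avgOrder G > 31 / 12 := fun hG => by
    obtain ⟨N, _, hN⟩ : ∃ N : Subgroup G, N.Normal ∧ Nat.card N = 3 := by
      by_contra! h
      exact hG (nonempty_mulEquiv_alternatingGroup hcard h)
    obtain ⟨b, hb⟩ := exists_orderOf_eq_six hcard hN
    have : (31 : ℚ) < psi G := by exact_mod_cast lt_psi_of_orderOf_eq_six hcard hb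
    rw [avgOrder, hcard]
    push_cast
    gcongr
  exact ⟨hlt, fun h => not_not.1 fun hG => (hlt hG).not_ge h, hle⟩
end
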